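/- Let (μ_n) and μ be finite Borel measures on ℝ such that μ_n → μ weakly. Then μ_n* → μ* weakly if and only if μ_n*(ℝ) → μ*(ℝ). -/

import Mathlib

open MeasureTheory Filter Topology

/-- Weak convergence of a sequence of finite Borel measures on `ℝ`:
`∫ f dμₙ → ∫ f dμ` for every bounded continuous `f : ℝ → ℝ`. -/
def WeakTendsto (μs : ℕ → Measure ℝ) (μ : Measure ℝ) : Prop :=
  ∀ f : ℝ → ℝ, Continuous f → (∃ C, ∀ x, |f x| ≤ C) →
    Tendsto (fun n => ∫ x, f x ∂(μs n)) atTop (𝓝 (∫ x, f x ∂μ))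

/-- The purely atomic measure `μ* = Σ_x μ({x})² δ_x`. -/
noncomputable def starMeasure (μ : Measure ℝ) : Measure ℝ :=
  Measure.sum (fun x : ℝ => (μ {x}) ^ 2 • Measure.dirac x)

namespace MeasureTheory.FiniteMeasure

theorem normalize_prod {α β : Type*} [MeasurableSpace α] [MeasurableSpace β]
    [Nonempty α] [Nonempty β] {μ : FiniteMeasure α} {ν : FiniteMeasure β}
    (hμ : μ ≠ 0) (hν : ν ≠ 0) :
    (μ.prod ν).normalize = μ.normalize.prod ν.normalize := by
  have hprod : μ.prod ν ≠ 0 := by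
    rw [← mass_nonzero_iff, mass_prod]
    exact mul_ne_zero (μ.mass_nonzero_iff.2 hμ) (ν.mass_nonzero_iff.2 hν)
  apply Subtype.ext
  change ((μ.prod ν).normalize : Measure (α × β)) =
    (μ.normalize : Measure α).prod (ν.normalize : Measure β)
  rw [toMeasure_normalize_eq_of_nonzero _ hprod, toMeasure_normalize_eq_of_nonzero _ hμ,
    toMeasure_normalize_eq_of_nonzero _ hν, mass_prod, mul_inv, toMeasure_prod]
  refine (Measure.prod_eq fun s t _ _ ↦ ?_).symm
  simp only [Measure.smul_apply, Measure.prod_prod, ENNReal.smul_def, smul_eq_mul,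
    ENNReal.coe_mul]
  ring

theorem tendsto_prod {ι α β : Type*} [MeasurableSpace α] [MeasurableSpace β]
    [TopologicalSpace α] [TopologicalSpace β] [SecondCountableTopology α]
    [SecondCountableTopology β] [TopologicalSpace.PseudoMetrizableSpace α]
    [TopologicalSpace.PseudoMetrizableSpace β]
    [OpensMeasurableSpace α] [OpensMeasurableSpace β] [Nonempty α] [Nonempty β]
    {L : Filter ι} {μs : ι → FiniteMeasure α} {μ : FiniteMeasure α}
    {νs : ι → FiniteMeasure β} {ν : FiniteMeasure β}
    (hμ : Tendsto μs L (𝓝 μ)) (hν : Tendsto νs L (𝓝 ν)) :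
    Tendsto (fun i ↦ (μs i).prod (νs i)) L (𝓝 (μ.prod ν)) := by
  have hmass : Tendsto (fun i ↦ ((μs i).prod (νs i)).mass) L (𝓝 (μ.prod ν).mass) := by
    simpa only [mass_prod] using hμ.mass.mul hν.mass
  by_cases h : μ = 0 ∨ ν = 0
  · have h0 : μ.prod ν = 0 := by rcases h with rfl | rfl <;> simp
    rw [h0, zero_mass] at hmass
    rw [h0]
    exact tendsto_zero_of_tendsto_zero_mass hmass
  push Not at h
  refine tendsto_of_tendsto_normalize_testAgainstNN_of_tendsto_mass ?_ hmass
  rw [normalize_prod h.1 h.2]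
  have hlim := (ProbabilityMeasure.continuous_prod.tendsto (μ.normalize, ν.normalize)).comp
    ((tendsto_normalize_of_tendsto hμ h.1).prodMk_nhds (tendsto_normalize_of_tendsto hν h.2))
  refine hlim.congr' ?_
  filter_upwards [hμ.mass.eventually_ne (μ.mass_nonzero_iff.2 h.1),
    hν.mass.eventually_ne (ν.mass_nonzero_iff.2 h.2)] with i hi hi'
  exact (normalize_prod ((mass_nonzero_iff _).1 hi) ((mass_nonzero_iff _).1 hi')).symm

section Closed

variable {Ω ι : Type*} [MeasurableSpace Ω] [TopologicalSpace Ω] [HasOuterApproxClosed Ω]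
  [OpensMeasurableSpace Ω] {L : Filter ι} {μs : ι → FiniteMeasure Ω} {μ : FiniteMeasure Ω}
  {F : Set Ω}

theorem eventually_setIntegral_lt_of_tendsto (hμ : Tendsto μs L (𝓝 μ)) (hF : IsClosed F)
    (f : BoundedContinuousFunction Ω ℝ) (hf : ∀ x, 0 ≤ f x) {b : ℝ}
    (hb : ∫ x in F, f x ∂(μ : Measure Ω) < b) :
    ∀ᶠ i in L, ∫ x in F, f x ∂(μs i : Measure Ω) < b := by
  have hbound (k : ℕ) (x : Ω) : ‖f x * (hF.apprSeq k x : ℝ)‖ ≤ ‖f‖ := by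
    rw [norm_mul, ← mul_one ‖f‖]
    have h1 : (hF.apprSeq k x : ℝ) ≤ 1 := by
      exact_mod_cast HasOuterApproxClosed.apprSeq_apply_le_one hF k x
    have h2 : ‖(hF.apprSeq k x : ℝ)‖ ≤ 1 := by
      rwa [Real.norm_of_nonneg (NNReal.coe_nonneg _)]
    exact mul_le_mul (f.norm_coe_le_norm x) h2 (norm_nonneg _) (norm_nonneg _)
  let g (k : ℕ) : BoundedContinuousFunction Ω ℝ :=
    BoundedContinuousFunction.ofNormedAddCommGroup (fun x ↦ f x * (hF.apprSeq k x : ℝ))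
      (by fun_prop) ‖f‖ (hbound k)
  have hlim : Tendsto (fun k ↦ ∫ x, g k x ∂(μ : Measure Ω)) atTop
      (𝓝 (∫ x in F, f x ∂(μ : Measure Ω))) := by
    rw [← integral_indicator hF.measurableSet]
    refine tendsto_integral_of_dominated_convergence (fun _ ↦ ‖f‖)
      (fun k ↦ ((g k).integrable _).aestronglyMeasurable) (integrable_const _)
      (fun k ↦ .of_forall (hbound k)) (.of_forall fun x ↦ ?_)
    have hx := (NNReal.continuous_coe.tendsto _).comp
      (tendsto_pi_nhds.1 (HasOuterApproxClosed.tendsto_apprSeq hF) x)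
    have hind : F.indicator f x = f x * ((F.indicator (fun _ ↦ 1) x : NNReal) : ℝ) := by
      by_cases hxF : x ∈ F <;> simp [hxF]
    rw [hind]
    exact hx.const_mul (f x)
  obtain ⟨k, hk⟩ := (hlim.eventually_lt_const hb).exists
  filter_upwards [(tendsto_iff_forall_integral_tendsto.1 hμ (g k)).eventually_lt_const hk]
    with i hi
  refine lt_of_le_of_lt ?_ hi
  rw [← integral_indicator hF.measurableSet]
  refine integral_mono ((f.integrable _).indicator hF.measurableSet) ((g k).integrable _)
    fun x ↦ ?_
  change F.indicator f x ≤ f x * (hF.apprSeq k x : ℝ)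
  by_cases hxF : x ∈ F
  · simp [hxF, HasOuterApproxClosed.apprSeq_apply_eq_one hF k hxF]
  · simpa [hxF] using mul_nonneg (hf x) (NNReal.coe_nonneg _)

theorem tendsto_setIntegral_of_tendsto_measureReal (hμ : Tendsto μs L (𝓝 μ)) (hF : IsClosed F)
    (hmass : Tendsto (fun i ↦ (μs i : Measure Ω).real F) L (𝓝 ((μ : Measure Ω).real F)))
    (f : BoundedContinuousFunction Ω ℝ) :
    Tendsto (fun i ↦ ∫ x in F, f x ∂(μs i : Measure Ω)) L
      (𝓝 (∫ x in F, f x ∂(μ : Measure Ω))) := by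
  have key (g : BoundedContinuousFunction Ω ℝ) (b : ℝ)
      (hb : ∫ x in F, g x ∂(μ : Measure Ω) < b) :
      ∀ᶠ i in L, ∫ x in F, g x ∂(μs i : Measure Ω) < b := by
    have shift (ν : FiniteMeasure Ω) :
        ∫ x in F, (BoundedContinuousFunction.const Ω ‖g‖ + g) x ∂(ν : Measure Ω) =
          (ν : Measure Ω).real F * ‖g‖ + ∫ x in F, g x ∂(ν : Measure Ω) := by
      simp only [BoundedContinuousFunction.coe_add, Pi.add_apply,
        BoundedContinuousFunction.const_apply]
      rw [integral_add (integrable_const _) (g.integrable _)]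
      simp
    obtain ⟨c, hc, hcb⟩ := exists_between hb
    have hlt := eventually_setIntegral_lt_of_tendsto hμ hF
      (BoundedContinuousFunction.const Ω ‖g‖ + g)
      (fun x ↦ by
        have := neg_le_of_abs_le (g.norm_coe_le_norm x)
        simp only [BoundedContinuousFunction.coe_add, Pi.add_apply,
          BoundedContinuousFunction.const_apply]
        linarith)
      (b := (μ : Measure Ω).real F * ‖g‖ + c) (by rw [shift]; linarith)
    filter_upwards [hlt, (hmass.mul_const ‖g‖).eventually_const_lt
      (show (μ : Measure Ω).real F * ‖g‖ - (b - c) < _ by linarith)] with i hi hi'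
    rw [shift] at hi
    linarith
  refine tendsto_order.2 ⟨fun a ha ↦ ?_, key f⟩
  filter_upwards [key (-f) (-a) (by simpa [integral_neg] using ha)] with i hi
  simpa [integral_neg] using hi

end Closed

end MeasureTheory.FiniteMeasure

theorem starMeasure_eq_map_restrict_diagonal (μ : Measure ℝ) [IsFiniteMeasure μ] :
    starMeasure μ = ((μ.prod μ).restrict (Set.diagonal ℝ)).map Prod.fst := by
  ext A hA
  have hS : {x | 0 < μ {x}}.Countable := Measure.countable_meas_level_set_pos measurable_id
  have hzero (x : ℝ) (hx : x ∉ {x | 0 < μ {x}}) : μ {x} = 0 := by simpa using hx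
  have hleft (x : ℝ) (hx : x ∉ A) : x ∉ A ∩ {x | 0 < μ {x}} := fun h ↦ hx h.1
  have hright (x : ℝ) (hx : x ∉ {x | 0 < μ {x}}) : x ∉ A ∩ {x | 0 < μ {x}} :=
    fun h ↦ hx h.2
  rw [Measure.map_apply measurable_fst hA, Measure.restrict_apply (measurable_fst hA),
    Measure.prod_apply ((measurable_fst hA).inter measurableSet_diagonal)]
  have hfiber (x : ℝ) : μ (Prod.mk x ⁻¹' (Prod.fst ⁻¹' A ∩ Set.diagonal ℝ)) =
      (A ∩ {x | 0 < μ {x}}).indicator (fun x ↦ μ {x}) x := by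
    by_cases hx : x ∈ A
    · have hset : Prod.mk x ⁻¹' (Prod.fst ⁻¹' A ∩ Set.diagonal ℝ) = {x} := by
        ext y; simp [hx, eq_comm]
      rw [hset]
      by_cases hxS : x ∈ {x | 0 < μ {x}}
      · rw [Set.indicator_of_mem (Set.mem_inter hx hxS)]
      · rw [Set.indicator_of_notMem (hright x hxS), hzero x hxS]
    · rw [Set.indicator_of_notMem (hleft x hx)]
      convert measure_empty (μ := μ)
      ext y; simp [hx]
  have hAS : (A ∩ {x | 0 < μ {x}}).Countable := hS.mono Set.inter_subset_right
  simp_rw [hfiber]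
  rw [lintegral_indicator hAS.measurableSet, lintegral_countable _ hAS,
    tsum_subtype (A ∩ {x | 0 < μ {x}}) (fun x ↦ μ {x} * μ {x}), starMeasure,
    Measure.sum_apply _ hA]
  refine tsum_congr fun x ↦ ?_
  rw [Measure.smul_apply, Measure.dirac_apply' _ hA, smul_eq_mul]
  by_cases hx : x ∈ A
  on_goal 1 => by_cases hxS : x ∈ {x | 0 < μ {x}}
  · rw [Set.indicator_of_mem hx, Set.indicator_of_mem (Set.mem_inter hx hxS), Pi.one_apply,
      mul_one, sq]
  · rw [hzero x hxS, Set.indicator_of_notMem (hright x hxS)]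
    simp
  · rw [Set.indicator_of_notMem hx, Set.indicator_of_notMem (hleft x hx), mul_zero]

theorem integral_starMeasure (μ : Measure ℝ) [IsFiniteMeasure μ] {f : ℝ → ℝ}
    (hf : Continuous f) :
    ∫ x, f x ∂(starMeasure μ) = ∫ p in Set.diagonal ℝ, f p.1 ∂(μ.prod μ) := by
  rw [starMeasure_eq_map_restrict_diagonal,
    integral_map measurable_fst.aemeasurable hf.aestronglyMeasurable]

theorem toReal_starMeasure_univ (μ : Measure ℝ) [IsFiniteMeasure μ] :
    (starMeasure μ Set.univ).toReal = (μ.prod μ).real (Set.diagonal ℝ) := by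
  rw [starMeasure_eq_map_restrict_diagonal, Measure.map_apply measurable_fst .univ,
    Set.preimage_univ, Measure.restrict_apply_univ, measureReal_def]

theorem WeakTendsto.tendsto_finiteMeasure {μs : ℕ → FiniteMeasure ℝ} {μ : FiniteMeasure ℝ}
    (h : WeakTendsto (fun n ↦ μs n) μ) : Tendsto μs atTop (𝓝 μ) :=
  FiniteMeasure.tendsto_iff_forall_integral_tendsto.2 fun f ↦
    h f f.continuous ⟨‖f‖, f.norm_coe_le_norm⟩

/-- Ethier–Kurtz: if `μₙ → μ` weakly, then `μₙ* → μ*` weakly iff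
`μₙ*(ℝ) → μ*(ℝ)`. -/
theorem starMeasure_weakTendsto_iff_mass_tendsto
    (μs : ℕ → Measure ℝ) (μ : Measure ℝ)
    (hfin : ∀ n, IsFiniteMeasure (μs n)) (hfinμ : IsFiniteMeasure μ)
    (hweak : WeakTendsto μs μ) :
    WeakTendsto (fun n => starMeasure (μs n)) (starMeasure μ) ↔
      Tendsto (fun n => (starMeasure (μs n) Set.univ).toReal) atTop
        (𝓝 ((starMeasure μ Set.univ).toReal)) := by
  constructor
  · intro h
    simpa [measureReal_def] using h (fun _ ↦ 1) continuous_const ⟨1, by simp⟩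
  · rintro h f hf ⟨C, hC⟩
    simp only [toReal_starMeasure_univ] at h
    simp only [integral_starMeasure _ hf]
    let νs (n : ℕ) : FiniteMeasure ℝ := ⟨μs n, hfin n⟩
    let ν : FiniteMeasure ℝ := ⟨μ, hfinμ⟩
    have hν : Tendsto νs atTop (𝓝 ν) := WeakTendsto.tendsto_finiteMeasure hweak
    exact FiniteMeasure.tendsto_setIntegral_of_tendsto_measureReal
      (FiniteMeasure.tendsto_prod hν hν) isClosed_diagonal h
      (BoundedContinuousFunction.ofNormedAddCommGroup (fun p : ℝ × ℝ ↦ f p.1)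
        (hf.comp continuous_fst) C fun p ↦ hC p.1)
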